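/- arXiv:0812.1304 — 2 statements merged into one kernel-verified Lean document; each statement's English description precedes it below -/
import Mathlib

section
/- Let R be a commutative ring such that every direct limit (filtered colimit) of strongly Gorenstein flat R-modules is strongly Gorenstein flat. Then the following statements are equivalent: (1) R is SG-semihereditary, i.e., R is coherent and every submodule of a flat R-module is strongly Gorenstein flat; (2) every finitely generated submodule of a projective R-module is strongly Gorenstein projective. -/
noncomputable section

universe u

variable (R : Type u) [CommRing R]

/-- `IsShortExact R f g` says that `0 → A → B → C → 0` is a short exact sequence. -/
def IsShortExact {A B C : Type u} [AddCommGroup A] [Module R A] [AddCommGroup B] [Module R B]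
    [AddCommGroup C] [Module R C] (f : A →ₗ[R] B) (g : B →ₗ[R] C) : Prop :=
  Function.Injective f ∧ Function.Surjective g ∧ LinearMap.range f = LinearMap.ker g

/-- A module `M` is Gorenstein projective if there is a complete projective resolution
`⋯ → P i → P (i+1) → ⋯` (an exact sequence of projective modules which remains exact after
applying `Hom(-, Q)` for every projective module `Q`) with `M ≅ Im (P 0 → P 1)`. -/
def IsGorensteinProjective (M : Type u) [AddCommGroup M] [Module R M] : Prop :=
  ∃ (P : ℤ → Type u) (_ : ∀ i, AddCommGroup (P i)) (_ : ∀ i, Module R (P i))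
    (d : ∀ i, P i →ₗ[R] P (i + 1)),
    (∀ i, Module.Projective R (P i)) ∧
    (∀ i, LinearMap.range (d i) = LinearMap.ker (d (i + 1))) ∧
    Nonempty (M ≃ₗ[R] LinearMap.range (d 0)) ∧
    (∀ (Q : Type u) (_ : AddCommGroup Q) (_ : Module R Q), Module.Projective R Q →
      ∀ (i : ℤ) (g : P (i + 1) →ₗ[R] Q), g.comp (d i) = 0 →
        ∃ h : P (i + 1 + 1) →ₗ[R] Q, h.comp (d (i + 1)) = g)

/-- A module `M` is strongly Gorenstein projective if there is a complete projective
resolution of the form `⋯ → P →f P →f P → ⋯` with `M ≅ Im f`. -/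
def IsStronglyGorensteinProjective (M : Type u) [AddCommGroup M] [Module R M] : Prop :=
  ∃ (P : Type u) (_ : AddCommGroup P) (_ : Module R P) (f : P →ₗ[R] P),
    Module.Projective R P ∧
    LinearMap.range f = LinearMap.ker f ∧
    Nonempty (M ≃ₗ[R] LinearMap.range f) ∧
    (∀ (Q : Type u) (_ : AddCommGroup Q) (_ : Module R Q), Module.Projective R Q →
      ∀ g : P →ₗ[R] Q, g.comp f = 0 → ∃ h : P →ₗ[R] Q, h.comp f = g)

/-- A module `M` is Gorenstein flat if there is an exact sequence of flat modules
`⋯ → F i → F (i+1) → ⋯` which remains exact after applying `- ⊗ I` for every injective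
module `I`, with `M ≅ Im (F 0 → F 1)`. -/
def IsGorensteinFlat (M : Type u) [AddCommGroup M] [Module R M] : Prop :=
  ∃ (F : ℤ → Type u) (_ : ∀ i, AddCommGroup (F i)) (_ : ∀ i, Module R (F i))
    (d : ∀ i, F i →ₗ[R] F (i + 1)),
    (∀ i, Module.Flat R (F i)) ∧
    (∀ i, LinearMap.range (d i) = LinearMap.ker (d (i + 1))) ∧
    Nonempty (M ≃ₗ[R] LinearMap.range (d 0)) ∧
    (∀ (I : Type u) (_ : AddCommGroup I) (_ : Module R I), Module.Injective R I →
      ∀ i : ℤ, LinearMap.range (LinearMap.rTensor I (d i)) =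
        LinearMap.ker (LinearMap.rTensor I (d (i + 1))))

/-- A module `M` is strongly Gorenstein flat if there is an exact sequence of flat modules
of the form `⋯ → F →f F →f F → ⋯` which remains exact after applying `- ⊗ I` for every
injective module `I`, with `M ≅ Im f`. -/
def IsStronglyGorensteinFlat (M : Type u) [AddCommGroup M] [Module R M] : Prop :=
  ∃ (F : Type u) (_ : AddCommGroup F) (_ : Module R F) (f : F →ₗ[R] F),
    Module.Flat R F ∧
    LinearMap.range f = LinearMap.ker f ∧
    Nonempty (M ≃ₗ[R] LinearMap.range f) ∧
    (∀ (I : Type u) (_ : AddCommGroup I) (_ : Module R I), Module.Injective R I →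
      LinearMap.range (LinearMap.rTensor I f) = LinearMap.ker (LinearMap.rTensor I f))

/-- `ProjDimLE R M n` : the projective dimension of `M` is at most `n`, i.e. there is an exact
sequence `0 → P n → ⋯ → P 0 → M → 0` with each `P i` projective. -/
def ProjDimLE (M : Type u) [AddCommGroup M] [Module R M] (n : ℕ) : Prop :=
  ∃ (P : ℕ → Type u) (_ : ∀ i, AddCommGroup (P i)) (_ : ∀ i, Module R (P i))
    (d : ∀ i, P (i + 1) →ₗ[R] P i) (ε : P 0 →ₗ[R] M),
    (∀ i, Module.Projective R (P i)) ∧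
    (∀ i, n < i → Subsingleton (P i)) ∧
    Function.Surjective ε ∧
    LinearMap.ker ε = LinearMap.range (d 0) ∧
    (∀ i, LinearMap.ker (d i) = LinearMap.range (d (i + 1)))

/-- `InjDimLE R M n` : the injective dimension of `M` is at most `n`, i.e. there is an exact
sequence `0 → M → E 0 → ⋯ → E n → 0` with each `E i` injective. -/
def InjDimLE (M : Type u) [AddCommGroup M] [Module R M] (n : ℕ) : Prop :=
  ∃ (E : ℕ → Type u) (_ : ∀ i, AddCommGroup (E i)) (_ : ∀ i, Module R (E i))
    (d : ∀ i, E i →ₗ[R] E (i + 1)) (η : M →ₗ[R] E 0),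
    (∀ i, Module.Injective R (E i)) ∧
    (∀ i, n < i → Subsingleton (E i)) ∧
    Function.Injective η ∧
    LinearMap.range η = LinearMap.ker (d 0) ∧
    (∀ i, LinearMap.range (d i) = LinearMap.ker (d (i + 1)))

/-- `FlatDimLE R M n` : the flat dimension of `M` is at most `n`. -/
def FlatDimLE (M : Type u) [AddCommGroup M] [Module R M] (n : ℕ) : Prop :=
  ∃ (F : ℕ → Type u) (_ : ∀ i, AddCommGroup (F i)) (_ : ∀ i, Module R (F i))
    (d : ∀ i, F (i + 1) →ₗ[R] F i) (ε : F 0 →ₗ[R] M),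
    (∀ i, Module.Flat R (F i)) ∧
    (∀ i, n < i → Subsingleton (F i)) ∧
    Function.Surjective ε ∧
    LinearMap.ker ε = LinearMap.range (d 0) ∧
    (∀ i, LinearMap.ker (d i) = LinearMap.range (d (i + 1)))

/-- `GProjDimLE R M n` : the Gorenstein projective dimension of `M` is at most `n`, i.e.
there is an exact sequence `0 → G n → ⋯ → G 0 → M → 0` with each `G i` Gorenstein
projective. -/
def GProjDimLE (M : Type u) [AddCommGroup M] [Module R M] (n : ℕ) : Prop :=
  ∃ (G : ℕ → Type u) (_ : ∀ i, AddCommGroup (G i)) (_ : ∀ i, Module R (G i))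
    (d : ∀ i, G (i + 1) →ₗ[R] G i) (ε : G 0 →ₗ[R] M),
    (∀ i, IsGorensteinProjective R (G i)) ∧
    (∀ i, n < i → Subsingleton (G i)) ∧
    Function.Surjective ε ∧
    LinearMap.ker ε = LinearMap.range (d 0) ∧
    (∀ i, LinearMap.ker (d i) = LinearMap.range (d (i + 1)))

/-- `GFlatDimLE R M n` : the Gorenstein flat dimension of `M` is at most `n`. -/
def GFlatDimLE (M : Type u) [AddCommGroup M] [Module R M] (n : ℕ) : Prop :=
  ∃ (G : ℕ → Type u) (_ : ∀ i, AddCommGroup (G i)) (_ : ∀ i, Module R (G i))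
    (d : ∀ i, G (i + 1) →ₗ[R] G i) (ε : G 0 →ₗ[R] M),
    (∀ i, IsGorensteinFlat R (G i)) ∧
    (∀ i, n < i → Subsingleton (G i)) ∧
    Function.Surjective ε ∧
    LinearMap.ker ε = LinearMap.range (d 0) ∧
    (∀ i, LinearMap.ker (d i) = LinearMap.range (d (i + 1)))

/-- A module is finitely presented if it is the quotient of a finite free module by a
finitely generated submodule of relations. -/
def IsFinitelyPresented (M : Type u) [AddCommGroup M] [Module R M] : Prop :=
  ∃ (n : ℕ) (f : (Fin n → R) →ₗ[R] M), Function.Surjective f ∧ (LinearMap.ker f).FG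

/-- A ring is coherent if every finitely generated ideal is finitely presented. -/
def IsCoherentRing : Prop :=
  ∀ I : Ideal R, I.FG → IsFinitelyPresented R I

/-- `ExtVanishes R M N i` : `Ext_R^i(M, N) = 0`. -/
def ExtVanishes (M N : Type u) [AddCommGroup M] [Module R M] [AddCommGroup N] [Module R N]
    (i : ℕ) : Prop :=
  Subsingleton (((Ext R (ModuleCat.{u} R) i).obj
    (Opposite.op (ModuleCat.of R M))).obj (ModuleCat.of R N))

/-- A ring is hereditary if every submodule of a projective module is projective. -/
def IsHereditaryRing : Prop :=
  ∀ (P : Type u) (_ : AddCommGroup P) (_ : Module R P), Module.Projective R P →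
    ∀ N : Submodule R P, Module.Projective R N

/-- A ring is semihereditary if every finitely generated ideal is projective. -/
def IsSemihereditaryRing : Prop :=
  ∀ I : Ideal R, I.FG → Module.Projective R I

/-- A ring is Gorenstein hereditary if every submodule of a projective module is
Gorenstein projective. -/
def IsGHereditaryRing : Prop :=
  ∀ (P : Type u) (_ : AddCommGroup P) (_ : Module R P), Module.Projective R P →
    ∀ N : Submodule R P, IsGorensteinProjective R N

/-- A ring is strongly Gorenstein hereditary if every submodule of a projective module is
strongly Gorenstein projective. -/
def IsSGHereditaryRing : Prop :=
  ∀ (P : Type u) (_ : AddCommGroup P) (_ : Module R P), Module.Projective R P →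
    ∀ N : Submodule R P, IsStronglyGorensteinProjective R N

/-- A ring is Gorenstein semihereditary if it is coherent and every submodule of a flat
module is Gorenstein flat. -/
def IsGSemihereditaryRing : Prop :=
  IsCoherentRing R ∧
    ∀ (F : Type u) (_ : AddCommGroup F) (_ : Module R F), Module.Flat R F →
      ∀ N : Submodule R F, IsGorensteinFlat R N

/-- A ring is strongly Gorenstein semihereditary if it is coherent and every submodule of a
flat module is strongly Gorenstein flat. -/
def IsSGSemihereditaryRing : Prop :=
  IsCoherentRing R ∧
    ∀ (F : Type u) (_ : AddCommGroup F) (_ : Module R F), Module.Flat R F →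
      ∀ N : Submodule R F, IsStronglyGorensteinFlat R N

section

open Function TensorProduct

variable {R}

section DualExact

variable {A B C : Type u} [AddCommGroup A] [Module R A] [AddCommGroup B] [Module R B]
  [AddCommGroup C] [Module R C] {f : A →ₗ[R] B} {g : B →ₗ[R] C}

/-- The evaluation map `A ⊗ E → Hom(A*, E)`. -/
def dualEvalTensor (A E : Type u) [AddCommGroup A] [Module R A] [AddCommGroup E] [Module R E] :
    A ⊗[R] E →ₗ[R] Module.Dual R A →ₗ[R] E :=
  dualTensorHom R (Module.Dual R A) E ∘ₗ (Module.Dual.eval R A).rTensor E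

theorem dualEvalTensor_bijective (E : Type u) [AddCommGroup E] [Module R E]
    [Module.Finite R A] [Module.Projective R A] :
    Bijective (dualEvalTensor (R := R) A E) := by
  rw [dualEvalTensor, LinearMap.coe_comp]
  exact (dualTensorHom_bijective (R := R)).comp
    (LinearEquiv.rTensor E (Module.evalEquiv R A)).bijective

theorem dualEvalTensor_rTensor {E : Type u} [AddCommGroup E] [Module R E] (f : A →ₗ[R] B)
    (t : A ⊗[R] E) :
    dualEvalTensor B E (f.rTensor E t) = dualEvalTensor A E t ∘ₗ f.dualMap := by
  induction t with
  | zero => simp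
  | add x y hx hy => simp [hx, hy, LinearMap.add_comp]
  | tmul a e => ext φ; simp [dualEvalTensor]

theorem rTensor_exact_of_dualMap_exact [Module.Finite R A] [Module.Projective R A]
    [Module.Finite R B] [Module.Projective R B] [Module.Finite R C] [Module.Projective R C]
    (h : Exact g.dualMap f.dualMap) (E : Type u) [AddCommGroup E] [Module R E]
    [Module.Injective R E] :
    Exact (f.rTensor E) (g.rTensor E) := by
  have hfg : f.dualMap ∘ₗ g.dualMap = 0 := h.linearMap_comp_eq_zero
  intro t
  constructor
  · intro ht
    have hker : LinearMap.ker f.dualMap ≤ LinearMap.ker (dualEvalTensor B E t) := by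
      intro x hx
      obtain ⟨y, rfl⟩ := (h x).1 hx
      have := dualEvalTensor_rTensor g t
      rw [ht, map_zero] at this
      exact (LinearMap.congr_fun this y).symm
    obtain ⟨ψ, hψ⟩ := Module.Injective.out
      ((LinearMap.ker f.dualMap).liftQ f.dualMap le_rfl)
      (LinearMap.ker_eq_bot.1 (Submodule.ker_liftQ_eq_bot' _ _ rfl))
      ((LinearMap.ker f.dualMap).liftQ (dualEvalTensor B E t) hker)
    obtain ⟨s, hs⟩ := (dualEvalTensor_bijective (R := R) (A := A) E).2 ψ
    refine ⟨s, (dualEvalTensor_bijective (R := R) (A := B) E).1 ?_⟩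
    rw [dualEvalTensor_rTensor, hs]
    ext x
    simpa using hψ ((LinearMap.ker f.dualMap).mkQ x)
  · rintro ⟨s, rfl⟩
    apply (dualEvalTensor_bijective (R := R) (A := C) E).1
    rw [dualEvalTensor_rTensor, dualEvalTensor_rTensor, LinearMap.comp_assoc, hfg]
    simp

theorem exists_linearMap_characterModule_apply_ne_zero {x : A} (hx : x ≠ 0) :
    ∃ φ : A →ₗ[R] CharacterModule R, φ x ≠ 0 := by
  obtain ⟨c, hc⟩ := CharacterModule.exists_character_apply_ne_zero_of_ne_zero hx
  refine ⟨CharacterModule.curry (CharacterModule.congr (TensorProduct.rid R A).symm c), ?_⟩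
  intro h
  apply hc
  have := congr($h 1)
  change c (TensorProduct.rid R A (x ⊗ₜ 1)) = 0 at this
  simpa using this

theorem dualMap_exact_of_rTensor_exact [Module.Finite R A] [Module.Projective R A]
    [Module.Finite R B] [Module.Projective R B] [Module.Finite R C] [Module.Projective R C]
    (hfg : g ∘ₗ f = 0)
    (h : Exact (f.rTensor (CharacterModule R)) (g.rTensor (CharacterModule R))) :
    Exact g.dualMap f.dualMap := by
  intro x
  constructor
  · intro hx
    by_contra hmem
    have hne : (LinearMap.range g.dualMap).mkQ x ≠ 0 := by
      simpa [Submodule.Quotient.mk_eq_zero] using hmem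
    obtain ⟨φ, hφ⟩ := exists_linearMap_characterModule_apply_ne_zero (R := R) hne
    obtain ⟨t, ht⟩ := (dualEvalTensor_bijective (R := R) (A := B) (CharacterModule R)).2
      (φ ∘ₗ (LinearMap.range g.dualMap).mkQ)
    have hgt : g.rTensor (CharacterModule R) t = 0 := by
      apply (dualEvalTensor_bijective (R := R) (A := C) (CharacterModule R)).1
      rw [dualEvalTensor_rTensor, ht, LinearMap.comp_assoc, LinearMap.range_mkQ_comp]
      simp
    obtain ⟨s, rfl⟩ := (h t).1 hgt
    apply hφ
    have := LinearMap.congr_fun ht x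
    rw [dualEvalTensor_rTensor, LinearMap.comp_apply, hx, map_zero] at this
    exact this.symm
  · rintro ⟨y, rfl⟩
    ext a
    simpa using congr(y ($hfg a))

theorem exists_comp_eq_of_dualMap_exact [Module.Finite R B] [Module.Projective R B]
    [Module.Finite R C] [Module.Projective R C] [Module.Finite R A] [Module.Projective R A]
    (h : Exact g.dualMap f.dualMap) {Q : Type u} [AddCommGroup Q] [Module R Q] [Module.Flat R Q]
    (k : B →ₗ[R] Q) (hk : k ∘ₗ f = 0) : ∃ l : C →ₗ[R] Q, l ∘ₗ g = k := by
  obtain ⟨t, rfl⟩ := (dualTensorHom_bijective (R := R) (M := B) (N := Q)).2 k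
  have nat {X Y : Type u} [AddCommGroup X] [Module R X] [AddCommGroup Y] [Module R Y]
      (u : X →ₗ[R] Y) (s : Module.Dual R Y ⊗[R] Q) :
      dualTensorHom R X Q (u.dualMap.rTensor Q s) = dualTensorHom R Y Q s ∘ₗ u :=
    LinearMap.congr_fun (dualTensorHom_comp_rTensor_dualMap (R := R) ..) s
  rw [← nat] at hk
  obtain ⟨s, rfl⟩ := (Module.Flat.rTensor_exact Q h t).1
    ((dualTensorHom_bijective (R := R)).1 (hk.trans (map_zero _).symm))
  exact ⟨dualTensorHom R C Q s, (nat g s).symm⟩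

end DualExact

theorem Module.FinitePresentation.isFinitelyPresented {M : Type u} [AddCommGroup M] [Module R M]
    [Module.FinitePresentation R M] : IsFinitelyPresented R M := by
  obtain ⟨n, f, hf⟩ := Module.Finite.exists_fin' R M
  exact ⟨n, f, hf, Module.FinitePresentation.fg_ker f hf⟩

theorem IsFinitelyPresented.finitePresentation {M : Type u} [AddCommGroup M] [Module R M]
    (h : IsFinitelyPresented R M) : Module.FinitePresentation R M := by
  obtain ⟨n, f, hf, hker⟩ := h
  exact Module.finitePresentation_of_surjective f hf hker

/-- A finite module over a coherent ring on which finitely many functionals separate points is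
finitely presented. -/
theorem IsCoherentRing.finitePresentation_of_separating (hR : IsCoherentRing R) (n : ℕ)
    {M : Type u} [AddCommGroup M] [Module R M] [Module.Finite R M] (φ : Fin n → Module.Dual R M)
    (hφ : ∀ x, (∀ i, φ i x = 0) → x = 0) : Module.FinitePresentation R M := by
  induction n generalizing M with
  | zero =>
    have : Subsingleton M := subsingleton_of_forall_eq 0 fun x ↦ hφ x fun i ↦ i.elim0
    infer_instance
  | succ n ih =>
    have hr : (LinearMap.range (φ 0)).FG := Module.Finite.iff_fg.1 inferInstance
    have := (hR (LinearMap.range (φ 0)) hr).finitePresentation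
    have hker : LinearMap.ker (φ 0).rangeRestrict = LinearMap.ker (φ 0) :=
      LinearMap.ker_rangeRestrict _
    have hfg := Module.FinitePresentation.fg_ker (φ 0).rangeRestrict
      (φ 0).surjective_rangeRestrict
    have := Module.Finite.iff_fg.2 hfg
    have : Module.FinitePresentation R (LinearMap.ker (φ 0).rangeRestrict) := by
      refine ih (fun i ↦ φ i.succ ∘ₗ Submodule.subtype _) fun x hx ↦ Subtype.ext <| hφ _ fun i ↦ ?_
      cases i using Fin.cases with
      | zero => simpa [hker] using x.2
      | succ i => exact hx i
    exact Module.finitePresentation_of_ker (φ 0).rangeRestrict (φ 0).surjective_rangeRestrict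

theorem IsCoherentRing.finitePresentation_of_fg_of_projective (hR : IsCoherentRing R)
    {P : Type u} [AddCommGroup P] [Module R P] [Module.Projective R P] {N : Submodule R P}
    (hN : N.FG) : Module.FinitePresentation R N := by
  classical
  obtain ⟨s, hs⟩ := (Module.projective_def' (R := R) (P := P)).1 inferInstance
  have hinj : Injective s := LinearMap.injective_of_comp_eq_id _ _ hs
  have : Module.Finite R N := Module.Finite.iff_fg.2 hN
  obtain ⟨t, rfl⟩ := hN
  let T : Finset P := t.biUnion fun x ↦ (s x).support
  have hT : Submodule.span R (t : Set P) ≤ (Finsupp.supported R R (T : Set P)).comap s := by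
    rw [Submodule.span_le]
    intro x hx
    simp only [SetLike.mem_coe, Submodule.mem_comap, Finsupp.mem_supported, Finset.coe_subset]
    exact Finset.subset_biUnion_of_mem (fun x ↦ (s x).support) hx
  refine hR.finitePresentation_of_separating T.card
    (fun i ↦ Finsupp.lapply (T.equivFin.symm i : P) ∘ₗ s ∘ₗ Submodule.subtype _)
    fun x hx ↦ Subtype.ext <| hinj ?_
  rw [Submodule.coe_zero, map_zero]
  ext p
  by_cases hp : p ∈ T
  · simpa using hx (T.equivFin ⟨p, hp⟩)
  · by_contra hne
    exact hp (hT x.2 (Finsupp.mem_support_iff.2 hne))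

theorem IsStronglyGorensteinFlat.of_equiv {M N : Type u} [AddCommGroup M] [Module R M]
    [AddCommGroup N] [Module R N] (h : IsStronglyGorensteinFlat R M) (e : N ≃ₗ[R] M) :
    IsStronglyGorensteinFlat R N := by
  obtain ⟨F, _, _, f, hF, hf, ⟨e'⟩, hI⟩ := h
  exact ⟨F, _, _, f, hF, hf, ⟨e.trans e'⟩, hI⟩

theorem Module.Finite.of_range_eq_ker {M P : Type u} [AddCommGroup M] [Module R M]
    [AddCommGroup P] [Module R P] {f : P →ₗ[R] P} (hf : LinearMap.range f = LinearMap.ker f)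
    (e : M ≃ₗ[R] LinearMap.range f) [Module.Finite R M] : Module.Finite R P := by
  have h1 : (LinearMap.range f).FG := Module.Finite.iff_fg.1 (.equiv e)
  refine ⟨Submodule.fg_of_fg_map_of_fg_inf_ker f ?_ ?_⟩
  · rwa [Submodule.map_top]
  · rwa [top_inf_eq, ← hf]

theorem IsStronglyGorensteinProjective.finitePresentation {M : Type u} [AddCommGroup M]
    [Module R M] [Module.Finite R M] (h : IsStronglyGorensteinProjective R M) :
    Module.FinitePresentation R M := by
  obtain ⟨P, _, _, f, hP, hf, ⟨e⟩, -⟩ := h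
  have := Module.Finite.of_range_eq_ker hf e
  have := Module.finitePresentation_of_projective R P
  have hker : (LinearMap.ker f.rangeRestrict).FG := by
    rw [LinearMap.ker_rangeRestrict, ← hf]
    exact Module.Finite.iff_fg.1 inferInstance
  have := Module.finitePresentation_of_surjective f.rangeRestrict f.surjective_rangeRestrict hker
  exact .of_equiv e.symm

theorem IsStronglyGorensteinProjective.isStronglyGorensteinFlat {M : Type u} [AddCommGroup M]
    [Module R M] [Module.Finite R M] (h : IsStronglyGorensteinProjective R M) :
    IsStronglyGorensteinFlat R M := by
  obtain ⟨P, _, _, f, hP, hf, ⟨e⟩, hQ⟩ := h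
  have := Module.Finite.of_range_eq_ker hf e
  refine ⟨P, _, _, f, inferInstance, hf, ⟨e⟩, fun I _ _ _ ↦ ?_⟩
  refine (LinearMap.exact_iff.1 (rTensor_exact_of_dualMap_exact (fun g ↦ ⟨fun hg ↦ ?_, ?_⟩) I)).symm
  · exact hQ R _ _ inferInstance g hg
  · rintro ⟨g, rfl⟩
    ext x
    have : f (f x) = 0 := hf.le ⟨x, rfl⟩
    simp [this]

theorem IsStronglyGorensteinFlat.isStronglyGorensteinProjective {M : Type u} [AddCommGroup M]
    [Module R M] [Module.FinitePresentation R M] (h : IsStronglyGorensteinFlat R M) :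
    IsStronglyGorensteinProjective R M := by
  obtain ⟨P, _, _, f, hP, hf, ⟨e⟩, hI⟩ := h
  have := Module.Finite.of_range_eq_ker hf e
  have : Module.FinitePresentation R (LinearMap.range f) := .of_equiv e
  have : Module.FinitePresentation R (LinearMap.ker f.rangeRestrict) := by
    rw [LinearMap.ker_rangeRestrict, ← hf]
    infer_instance
  have := Module.finitePresentation_of_ker f.rangeRestrict f.surjective_rangeRestrict
  have : Module.Projective R P := Module.Flat.projective_of_finitePresentation
  have : Module.Injective R (CharacterModule R) :=
    Module.Flat.iff_characterModule_injective.1 inferInstance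
  have hff : f ∘ₗ f = 0 := LinearMap.ext fun x ↦ hf.le ⟨x, rfl⟩
  exact ⟨P, _, _, f, inferInstance, hf, ⟨e⟩, fun Q _ _ _ k hk ↦
    exists_comp_eq_of_dualMap_exact
      (dualMap_exact_of_rTensor_exact hff (LinearMap.exact_iff.2 (hI _ _ _ inferInstance).symm))
      k hk⟩

section Presentation

variable {L N : Type u} [AddCommGroup L] [Module R L] [AddCommGroup N] [Module R N]

/-- A pair `B ≤ A` of submodules of `L`, with `A` finitely generated and `B ≤ ker π`, such that
`A ⧸ B` embeds in a finite free module. -/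
def IsTorsionlessPair (π : L →ₗ[R] N) (p : Submodule R L × Submodule R L) : Prop :=
  p.1.FG ∧ p.2 ≤ p.1 ∧ p.2 ≤ LinearMap.ker π ∧
    ∃ (n : ℕ) (u : p.1 →ₗ[R] Fin n →₀ R), LinearMap.ker u = p.2.submoduleOf p.1

variable {π : L →ₗ[R] N}

theorem IsTorsionlessPair.exists_equiv {p : Submodule R L × Submodule R L}
    (hp : IsTorsionlessPair π p) : ∃ (n : ℕ) (S : Submodule R (Fin n →₀ R)), S.FG ∧
      Nonempty ((p.1 ⧸ p.2.submoduleOf p.1) ≃ₗ[R] S) := by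
  obtain ⟨h1, -, -, n, u, hu⟩ := hp
  have := Module.Finite.iff_fg.2 h1
  exact ⟨n, LinearMap.range u, Module.Finite.iff_fg.1 inferInstance,
    ⟨(Submodule.quotEquivOfEq _ _ hu.symm).trans u.quotKerEquivRange⟩⟩

theorem IsTorsionlessPair.fg_snd
    (hfp : ∀ (n : ℕ) (S : Submodule R (Fin n →₀ R)), S.FG → Module.FinitePresentation R S)
    {p : Submodule R L × Submodule R L} (hp : IsTorsionlessPair π p) : p.2.FG := by
  obtain ⟨n, S, hS, ⟨e⟩⟩ := hp.exists_equiv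
  have := hfp n S hS
  have := Module.Finite.iff_fg.2 hp.1
  have : Module.FinitePresentation R (p.1 ⧸ p.2.submoduleOf p.1) :=
    .of_equiv (M := S) e.symm
  have hk := (Module.FinitePresentation.fg_ker (p.2.submoduleOf p.1).mkQ
    (Submodule.mkQ_surjective _)).map p.1.subtype
  rwa [Submodule.ker_mkQ, Submodule.submoduleOf, Submodule.map_comap_subtype,
    inf_eq_right.2 hp.2.1] at hk

theorem exists_isTorsionlessPair {F : Type u} [AddCommGroup F] [Module R F] [Module.Flat R F]
    {j : N →ₗ[R] F} (hj : Injective j) {A B : Submodule R L} [Module.FinitePresentation R A]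
    (hB : B.FG) (hBA : B ≤ A) (hBπ : B ≤ LinearMap.ker π) :
    ∃ B', B ≤ B' ∧ IsTorsionlessPair π (A, B') := by
  have hBfg : (B.submoduleOf A).FG := by
    refine Submodule.fg_of_fg_map_injective A.subtype A.subtype_injective ?_
    rwa [Submodule.submoduleOf, Submodule.map_comap_subtype, inf_eq_right.2 hBA]
  have : Module.FinitePresentation R (A ⧸ B.submoduleOf A) :=
    Module.finitePresentation_of_surjective (B.submoduleOf A).mkQ (Submodule.mkQ_surjective _)
      (by rwa [Submodule.ker_mkQ])
  let θ : (A ⧸ B.submoduleOf A) →ₗ[R] F :=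
    (B.submoduleOf A).liftQ (j ∘ₗ π ∘ₗ A.subtype) fun x hx ↦ by
      have : π x = 0 := hBπ hx
      simp [this]
  obtain ⟨n, v, w, hvw⟩ := Module.Flat.exists_factorization_of_finitePresentation θ
  let u := v ∘ₗ (B.submoduleOf A).mkQ
  refine ⟨(LinearMap.ker u).map A.subtype, fun x hx ↦ ?_, Module.Finite.iff_fg.1 inferInstance,
    Submodule.map_subtype_le _ _, ?_, n, u, ?_⟩
  · refine ⟨⟨x, hBA hx⟩, ?_, rfl⟩
    have : (B.submoduleOf A).mkQ ⟨x, hBA hx⟩ = 0 := (Submodule.Quotient.mk_eq_zero _).2 hx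
    simp only [SetLike.mem_coe, LinearMap.mem_ker, u, LinearMap.comp_apply, this, map_zero]
  · rintro _ ⟨x, hx, rfl⟩
    apply hj
    have h1 : θ ((B.submoduleOf A).mkQ x) = w (u x) := by rw [hvw]; rfl
    rw [LinearMap.mem_ker.1 hx, map_zero] at h1
    simpa [θ] using h1
  · exact (Submodule.comap_map_eq_of_injective A.subtype_injective _).symm

/-- Suppose that strongly Gorenstein flat modules are closed under direct limits. If every pair of
finitely generated submodules `B ≤ A ⊓ ker π` can be enlarged to a torsionless pair `(A, B')`, then
the target `N` of `π` is the direct limit of the quotients of torsionless pairs, and hence is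
strongly Gorenstein flat. -/
theorem isStronglyGorensteinFlat_of_torsionlessPairs
    (hlim : ∀ (ι : Type u) (_ : Preorder ι) (_ : DecidableEq ι)
      (_ : IsDirected ι (· ≤ ·)) (_ : Nonempty ι)
      (G : ι → Type u) (_ : ∀ i, AddCommGroup (G i)) (_ : ∀ i, Module R (G i))
      (f : ∀ i j, i ≤ j → G i →ₗ[R] G j) (_ : DirectedSystem G fun i j h => f i j h),
      (∀ i, IsStronglyGorensteinFlat R (G i)) →
        IsStronglyGorensteinFlat R (Module.DirectLimit G f))
    (hfree : ∀ (n : ℕ) (S : Submodule R (Fin n →₀ R)), S.FG →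
      Module.FinitePresentation R S ∧ IsStronglyGorensteinFlat R S)
    (hex : ∀ A B : Submodule R L, A.FG → B.FG → B ≤ A → B ≤ LinearMap.ker π →
      ∃ B', B ≤ B' ∧ IsTorsionlessPair π (A, B'))
    (hπ : Surjective π) : IsStronglyGorensteinFlat R N := by
  classical
  let ι := {p : Submodule R L × Submodule R L // IsTorsionlessPair π p}
  let G : ι → Type u := fun p ↦ p.1.1 ⧸ p.1.2.submoduleOf p.1.1
  let f : ∀ p q : ι, p ≤ q → G p →ₗ[R] G q := fun p q h ↦
    Submodule.mapQ _ _ (Submodule.inclusion h.1) fun x hx ↦ h.2 hx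
  have hne : Nonempty ι := by
    obtain ⟨B', -, hB'⟩ := hex ⊥ ⊥ Submodule.fg_bot Submodule.fg_bot le_rfl bot_le
    exact ⟨⟨_, hB'⟩⟩
  have hdir : IsDirected ι (· ≤ ·) := by
    refine ⟨fun p q ↦ ?_⟩
    have hp := p.2.fg_snd fun n S hS ↦ (hfree n S hS).1
    have hq := q.2.fg_snd fun n S hS ↦ (hfree n S hS).1
    obtain ⟨B', hle, hB'⟩ := hex (p.1.1 ⊔ q.1.1) (p.1.2 ⊔ q.1.2) (p.2.1.sup q.2.1) (hp.sup hq)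
      (sup_le_sup p.2.2.1 q.2.2.1) (sup_le p.2.2.2.1 q.2.2.2.1)
    exact ⟨⟨_, hB'⟩, ⟨le_sup_left, le_sup_left.trans hle⟩, ⟨le_sup_right, le_sup_right.trans hle⟩⟩
  have hsys : DirectedSystem G fun i j h => f i j h :=
    ⟨fun p x ↦ by obtain ⟨x, rfl⟩ := Submodule.mkQ_surjective _ x; rfl,
      fun _ _ _ _ _ x ↦ by obtain ⟨x, rfl⟩ := Submodule.mkQ_surjective _ x; rfl⟩
  have hG : ∀ p, IsStronglyGorensteinFlat R (G p) := fun p ↦ by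
    obtain ⟨n, S, hS, ⟨e⟩⟩ := p.2.exists_equiv
    exact (hfree n S hS).2.of_equiv e
  let g : ∀ p, G p →ₗ[R] N := fun p ↦
    (p.1.2.submoduleOf p.1.1).liftQ (π ∘ₗ p.1.1.subtype) fun x hx ↦ p.2.2.2.1 hx
  let Φ : Module.DirectLimit G f →ₗ[R] N := Module.DirectLimit.lift R ι G f g fun p q h x ↦ by
    obtain ⟨x, rfl⟩ := Submodule.mkQ_surjective _ x; rfl
  refine (hlim ι _ _ hdir hne G _ _ f hsys hG).of_equiv (LinearEquiv.ofBijective Φ ⟨?_, ?_⟩).symm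
  · rw [injective_iff_map_eq_zero]
    intro z hz
    obtain ⟨p, x, rfl⟩ := Module.DirectLimit.exists_of z
    obtain ⟨x, rfl⟩ := Submodule.mkQ_surjective _ x
    have hx : π x = 0 := by
      rw [Module.DirectLimit.lift_of] at hz
      exact hz
    have hspan : Submodule.span R {(x : L)} ≤ LinearMap.ker π := by simpa using hx
    obtain ⟨B', hle, hB'⟩ := hex (Submodule.span R {(x : L)}) (Submodule.span R {(x : L)})
      (Submodule.fg_span_singleton _) (Submodule.fg_span_singleton _) le_rfl hspan
    obtain ⟨q, hpq, hq⟩ := exists_ge_ge p (⟨_, hB'⟩ : ι)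
    have hxq : (x : L) ∈ q.1.2 := hq.2 (hle (Submodule.mem_span_singleton_self _))
    rw [← Module.DirectLimit.of_f (hij := hpq)]
    have : f p q hpq ((p.1.2.submoduleOf p.1.1).mkQ x) = 0 :=
      (Submodule.Quotient.mk_eq_zero _).2 hxq
    rw [this, map_zero]
  · intro y
    obtain ⟨l, rfl⟩ := hπ y
    obtain ⟨B', -, hB'⟩ := hex (Submodule.span R {l}) ⊥ (Submodule.fg_span_singleton _)
      Submodule.fg_bot bot_le bot_le
    refine ⟨Module.DirectLimit.of R ι G f ⟨_, hB'⟩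
      (Submodule.mkQ _ ⟨l, Submodule.mem_span_singleton_self l⟩), ?_⟩
    rw [Module.DirectLimit.lift_of]
    rfl

end Presentation

end

/-- Theorem 3.4: if direct limits of strongly Gorenstein flat modules are strongly Gorenstein
flat, then `R` is strongly Gorenstein semihereditary iff every finitely generated submodule
of a projective module is strongly Gorenstein projective. -/
theorem statement_15 (R : Type u) [CommRing R]
    (hlim : ∀ (ι : Type u) (_ : Preorder ι) (_ : DecidableEq ι)
      (_ : IsDirected ι (· ≤ ·)) (_ : Nonempty ι)
      (G : ι → Type u) (_ : ∀ i, AddCommGroup (G i)) (_ : ∀ i, Module R (G i))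
      (f : ∀ i j, i ≤ j → G i →ₗ[R] G j) (_ : DirectedSystem G fun i j h => f i j h),
      (∀ i, IsStronglyGorensteinFlat R (G i)) →
        IsStronglyGorensteinFlat R (Module.DirectLimit G f)) :
    IsSGSemihereditaryRing R ↔
      ∀ (P : Type u) (_ : AddCommGroup P) (_ : Module R P), Module.Projective R P →
        ∀ N : Submodule R P, N.FG → IsStronglyGorensteinProjective R N := by
  constructor
  · rintro ⟨hcoh, hflat⟩ P _ _ _ N hN
    have := hcoh.finitePresentation_of_fg_of_projective hN
    exact (hflat P _ _ inferInstance N).isStronglyGorensteinProjective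
  · intro h
    have hfg : ∀ (P : Type u) (_ : AddCommGroup P) (_ : Module R P), Module.Projective R P →
        ∀ N : Submodule R P, N.FG →
          Module.FinitePresentation R N ∧ IsStronglyGorensteinFlat R N := by
      intro P _ _ hP N hN
      have := Module.Finite.iff_fg.2 hN
      exact ⟨(h P _ _ hP N hN).finitePresentation, (h P _ _ hP N hN).isStronglyGorensteinFlat⟩
    refine ⟨fun I hI ↦ ?_, fun F _ _ _ N ↦ ?_⟩
    · have := (hfg R _ _ inferInstance I hI).1
      exact Module.FinitePresentation.isFinitelyPresented
    · refine isStronglyGorensteinFlat_of_torsionlessPairs (L := N →₀ R)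
        (π := Finsupp.linearCombination R id) hlim (fun n S ↦ hfg _ _ _ inferInstance S)
        (fun A B hA hB hBA hBπ ↦ ?_) (Finsupp.linearCombination_id_surjective R N)
      have := (hfg _ _ _ inferInstance A hA).1
      exact exists_isTorsionlessPair N.subtype_injective hB hBA hBπ
end
end

section
/- Let R be a coherent commutative ring. An R-module is Gorenstein flat if, and only if, it is a direct summand of a strongly Gorenstein flat R-module. -/
noncomputable section

universe u

variable (R : Type u) [CommRing R]

section Homological

open CategoryTheory Abelian TensorProduct

variable {R}
variable {A B C : Type u} [AddCommGroup A] [Module R A] [AddCommGroup B] [Module R B]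
  [AddCommGroup C] [Module R C] {f : A →ₗ[R] B} {g : B →ₗ[R] C}

theorem ext_one_subsingleton_of_exact (D : ModuleCat.{u} R) (hf : Function.Injective f)
    (hfg : Function.Exact f g) (hg : Function.Surjective g)
    (hB : Subsingleton (Abelian.Ext (ModuleCat.of R B) D 1))
    (hext : Function.Surjective (f.lcomp R D)) :
    Subsingleton (Abelian.Ext (ModuleCat.of R C) D 1) := by
  have hS : (ShortComplex.mk (ModuleCat.ofHom f) (ModuleCat.ofHom g)
      (by ext x; exact hfg.apply_apply_eq_zero x)).ShortExact :=
    ModuleCat.shortComplex_shortExact _ hfg hf hg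
  refine subsingleton_of_forall_eq 0 fun x ↦ ?_
  obtain ⟨y, rfl⟩ := Ext.contravariant_sequence_exact₃ hS D x (hB.elim _ _) (add_zero 1)
  obtain ⟨φ, rfl⟩ := (Ext.mk₀_bijective _ _).2 y
  obtain ⟨ψ, hψ⟩ := hext φ.hom
  have : φ = ModuleCat.ofHom f ≫ ModuleCat.ofHom ψ := by
    ext a
    exact (LinearMap.congr_fun hψ a).symm
  rw [this, ← Ext.mk₀_comp_mk₀, hS.extClass_comp_assoc]

theorem ext_succ_subsingleton_of_exact (D : ModuleCat.{u} R) (hf : Function.Injective f)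
    (hfg : Function.Exact f g) (hg : Function.Surjective g) (n : ℕ)
    (hA : Subsingleton (Abelian.Ext (ModuleCat.of R A) D n))
    (hB : Subsingleton (Abelian.Ext (ModuleCat.of R B) D (n + 1))) :
    Subsingleton (Abelian.Ext (ModuleCat.of R C) D (n + 1)) := by
  have hS : (ShortComplex.mk (ModuleCat.ofHom f) (ModuleCat.ofHom g)
      (by ext x; exact hfg.apply_apply_eq_zero x)).ShortExact :=
    ModuleCat.shortComplex_shortExact _ hfg hf hg
  refine subsingleton_of_forall_eq 0 fun x ↦ ?_
  obtain ⟨y, rfl⟩ := Ext.contravariant_sequence_exact₃ hS D x (hB.elim _ _) (add_comm 1 n)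
  rw [hA.elim y 0, Ext.comp_zero]

theorem lcomp_surjective_of_ext_one (D : ModuleCat.{u} R) (hf : Function.Injective f)
    (hfg : Function.Exact f g) (hg : Function.Surjective g)
    (hC : Subsingleton (Abelian.Ext (ModuleCat.of R C) D 1)) :
    Function.Surjective (f.lcomp R D) := by
  have hS : (ShortComplex.mk (ModuleCat.ofHom f) (ModuleCat.ofHom g)
      (by ext x; exact hfg.apply_apply_eq_zero x)).ShortExact :=
    ModuleCat.shortComplex_shortExact _ hfg hf hg
  intro φ
  obtain ⟨y, hy⟩ := Ext.contravariant_sequence_exact₁ hS D (Ext.mk₀ (ModuleCat.ofHom φ))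
    (add_zero 1) (hC.elim _ _)
  obtain ⟨ψ, rfl⟩ := (Ext.mk₀_bijective _ _).2 y
  rw [Ext.mk₀_comp_mk₀] at hy
  have := (Ext.mk₀_bijective _ _).1 hy
  exact ⟨ψ.hom, congrArg ModuleCat.Hom.hom this⟩

variable (R) in
/-- `CharExtVanishes R M` : all `Ext^n(M, I⁺)`, `n ≥ 1`, vanish for `I` injective, where `I⁺` is
the character module of `I`; equivalently, all `Tor_n(M, I)` vanish. -/
def CharExtVanishes (M : Type u) [AddCommGroup M] [Module R M] : Prop :=
  ∀ (I : Type u) (_ : AddCommGroup I) (_ : Module R I), Module.Injective R I → ∀ n : ℕ,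
    Subsingleton (Abelian.Ext (ModuleCat.of R M) (ModuleCat.of R (CharacterModule I)) (n + 1))

theorem CharExtVanishes.of_retract {M N : Type u} [AddCommGroup M] [Module R M] [AddCommGroup N]
    [Module R N] (hN : CharExtVanishes R N) (i : M →ₗ[R] N) (p : N →ₗ[R] M)
    (h : p.comp i = LinearMap.id) : CharExtVanishes R M := by
  intro I _ _ hI n
  have := hN I _ _ hI n
  refine subsingleton_of_forall_eq 0 fun x ↦ ?_
  have h' : ModuleCat.ofHom i ≫ ModuleCat.ofHom p = 𝟙 _ := by
    rw [← ModuleCat.ofHom_comp, h]; rfl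
  rw [← Ext.mk₀_id_comp x, ← h', ← Ext.mk₀_comp_mk₀_assoc,
    Subsingleton.elim ((Ext.mk₀ (ModuleCat.ofHom p)).comp x (zero_add _)) 0, Ext.comp_zero]

theorem CharExtVanishes.middle (hfg : IsShortExact R f g) (hA : CharExtVanishes R A)
    (hC : CharExtVanishes R C) : CharExtVanishes R B := by
  intro I _ _ hI n
  have := hA I _ _ hI n
  have := hC I _ _ hI n
  have hex := LinearMap.exact_iff.mpr hfg.2.2.symm
  have hS : (ShortComplex.mk (ModuleCat.ofHom f) (ModuleCat.ofHom g)
      (by ext x; exact hex.apply_apply_eq_zero x)).ShortExact :=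
    ModuleCat.shortComplex_shortExact _ hex hfg.1 hfg.2.1
  refine subsingleton_of_forall_eq 0 fun x ↦ ?_
  obtain ⟨y, rfl⟩ := Ext.contravariant_sequence_exact₂ hS _ x (Subsingleton.elim (α :=
    Abelian.Ext (ModuleCat.of R A) (ModuleCat.of R (CharacterModule I)) (n + 1)) _ _)
  rw [Subsingleton.elim (α :=
    Abelian.Ext (ModuleCat.of R C) (ModuleCat.of R (CharacterModule I)) (n + 1)) y 0, Ext.comp_zero]

theorem CharExtVanishes.left (hfg : IsShortExact R f g) (hB : CharExtVanishes R B)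
    (hC : CharExtVanishes R C) : CharExtVanishes R A := by
  intro I _ _ hI n
  have := hB I _ _ hI n
  have := hC I _ _ hI (n + 1)
  have hex := LinearMap.exact_iff.mpr hfg.2.2.symm
  have hS : (ShortComplex.mk (ModuleCat.ofHom f) (ModuleCat.ofHom g)
      (by ext x; exact hex.apply_apply_eq_zero x)).ShortExact :=
    ModuleCat.shortComplex_shortExact _ hex hfg.1 hfg.2.1
  refine subsingleton_of_forall_eq 0 fun x ↦ ?_
  obtain ⟨y, rfl⟩ := Ext.contravariant_sequence_exact₁ hS _ x (add_comm 1 (n + 1))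
    (Subsingleton.elim (α :=
      Abelian.Ext (ModuleCat.of R C) (ModuleCat.of R (CharacterModule I)) (n + 1 + 1)) _ _)
  rw [Subsingleton.elim (α :=
    Abelian.Ext (ModuleCat.of R B) (ModuleCat.of R (CharacterModule I)) (n + 1)) y 0, Ext.comp_zero]

theorem CharExtVanishes.lcomp_surjective (hfg : IsShortExact R f g) (hC : CharExtVanishes R C)
    (I : Type u) [AddCommGroup I] [Module R I] (hI : Module.Injective R I) :
    Function.Surjective (f.lcomp R (CharacterModule I)) :=
  lcomp_surjective_of_ext_one (ModuleCat.of R (CharacterModule I)) hfg.1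
    (LinearMap.exact_iff.mpr hfg.2.2.symm) hfg.2.1 (hC I _ _ hI 0)

theorem CharExtVanishes.rTensor_injective (hfg : IsShortExact R f g) (hC : CharExtVanishes R C)
    (I : Type u) [AddCommGroup I] [Module R I] (hI : Module.Injective R I) :
    Function.Injective (f.rTensor I) :=
  rTensor_injective_iff_lcomp_surjective.mpr (hC.lcomp_surjective hfg I hI)

theorem rTensor_injective_of_flat_right (hfg : IsShortExact R f g) [Module.Flat R C]
    (X : Type u) [AddCommGroup X] [Module R X] : Function.Injective (f.rTensor X) := by
  rw [← LinearMap.lTensor_inj_iff_rTensor_inj]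
  exact LinearMap.lTensor_injective_of_exact_of_flat g hfg.2.1 f hfg.1
    (LinearMap.exact_iff.mpr hfg.2.2.symm) X

theorem isShortExact_ker (hg : Function.Surjective g) :
    IsShortExact R (LinearMap.ker g).subtype g :=
  ⟨Subtype.val_injective, hg, Submodule.range_subtype _⟩

theorem isShortExact_mkQ (hf : Function.Injective f) :
    IsShortExact R f (LinearMap.range f).mkQ :=
  ⟨hf, Submodule.mkQ_surjective _, (Submodule.ker_mkQ _).symm⟩

theorem flat_left_of_isShortExact (hfg : IsShortExact R f g) [Module.Flat R B] [Module.Flat R C] :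
    Module.Flat R A := by
  rw [Module.Flat.iff_lTensor_preserves_injective_linearMap']
  intro N P _ _ _ _ i hi
  refine Function.Injective.of_comp (f := f.rTensor P) ?_
  rw [← LinearMap.coe_comp, LinearMap.rTensor_comp_lTensor, ← LinearMap.lTensor_comp_rTensor,
    LinearMap.coe_comp]
  exact (Module.Flat.lTensor_preserves_injective_linearMap i hi).comp
    (rTensor_injective_of_flat_right hfg N)

theorem flat_middle_of_isShortExact (hfg : IsShortExact R f g) [Module.Flat R A]
    [Module.Flat R C] : Module.Flat R B := by
  rw [Module.Flat.iff_lTensor_preserves_injective_linearMap']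
  intro N P _ _ _ _ i hi
  rw [injective_iff_map_eq_zero]
  intro x hx
  have hex := LinearMap.exact_iff.mpr hfg.2.2.symm
  have h0 : g.rTensor N x = 0 := by
    apply Module.Flat.lTensor_preserves_injective_linearMap (M := C) i hi
    rw [← LinearMap.comp_apply, LinearMap.lTensor_comp_rTensor,
      ← LinearMap.rTensor_comp_lTensor, LinearMap.comp_apply, hx, map_zero, map_zero]
  obtain ⟨a, rfl⟩ := (rTensor_exact N hex hfg.2.1 x).1 h0
  suffices a = 0 by rw [this, map_zero]
  apply Module.Flat.lTensor_preserves_injective_linearMap (M := A) i hi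
  apply rTensor_injective_of_flat_right hfg P
  rw [map_zero, map_zero, ← hx, ← LinearMap.comp_apply, ← LinearMap.comp_apply,
    LinearMap.lTensor_comp_rTensor, LinearMap.rTensor_comp_lTensor]

/-- The quotient of a flat module by a pure submodule is flat. -/
theorem flat_right_of_isShortExact (hfg : IsShortExact R f g) [Module.Flat R B]
    (hpure : ∀ (X : Type u) [AddCommGroup X] [Module R X], Function.Injective (f.rTensor X)) :
    Module.Flat R C := by
  rw [Module.Flat.iff_lTensor_preserves_injective_linearMap']
  intro N P _ _ _ _ i hi
  rw [injective_iff_map_eq_zero]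
  intro x hx
  have hex := LinearMap.exact_iff.mpr hfg.2.2.symm
  have hexi := (isShortExact_mkQ hi)
  have hiq := LinearMap.exact_iff.mpr hexi.2.2.symm
  obtain ⟨y, rfl⟩ := LinearMap.rTensor_surjective N hfg.2.1 x
  have h0 : g.rTensor P (i.lTensor B y) = 0 := by
    rw [← hx, ← LinearMap.comp_apply, ← LinearMap.comp_apply,
      LinearMap.lTensor_comp_rTensor, LinearMap.rTensor_comp_lTensor]
  obtain ⟨a, ha⟩ := (rTensor_exact P hex hfg.2.1 _).1 h0
  have h1 : (LinearMap.range i).mkQ.lTensor A a = 0 := by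
    apply hpure
    rw [map_zero, ← LinearMap.comp_apply, LinearMap.rTensor_comp_lTensor,
      ← LinearMap.lTensor_comp_rTensor, LinearMap.comp_apply, ha, ← LinearMap.comp_apply,
      ← LinearMap.lTensor_comp, hiq.linearMap_comp_eq_zero, LinearMap.lTensor_zero,
      LinearMap.zero_apply]
  obtain ⟨b, rfl⟩ := (lTensor_exact A hiq hexi.2.1 a).1 h1
  have h2 : y = f.rTensor N b := by
    apply Module.Flat.lTensor_preserves_injective_linearMap (M := B) i hi
    rw [← ha, ← LinearMap.comp_apply, ← LinearMap.comp_apply,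
      LinearMap.lTensor_comp_rTensor, LinearMap.rTensor_comp_lTensor]
  rw [h2, ← LinearMap.comp_apply, ← LinearMap.rTensor_comp, hex.linearMap_comp_eq_zero,
    LinearMap.rTensor_zero, LinearMap.zero_apply]

theorem exists_projective_surjective (R : Type u) [CommRing R] (M : Type u) [AddCommGroup M]
    [Module R M] : ∃ (P : Type u) (_ : AddCommGroup P) (_ : Module R P) (g : P →ₗ[R] M),
      Module.Projective R P ∧ Function.Surjective g :=
  ⟨M →₀ R, inferInstance, inferInstance, Finsupp.linearCombination R id, inferInstance,
    Finsupp.linearCombination_surjective R Function.surjective_id⟩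

theorem ext_subsingleton_of_projective (P : Type u) [AddCommGroup P] [Module R P]
    [Module.Projective R P] (D : ModuleCat.{u} R) (n : ℕ) :
    Subsingleton (Abelian.Ext (ModuleCat.of R P) D (n + 1)) :=
  have : CategoryTheory.Projective (ModuleCat.of R P) :=
    (IsProjective.iff_projective _).mp inferInstance
  Ext.subsingleton_of_projective _ _ _

theorem charExtVanishes_of_flat (M : Type u) [AddCommGroup M] [Module R M] [Module.Flat R M] :
    CharExtVanishes R M := by
  intro I _ _ hI n
  induction n generalizing M with
  | zero =>
    obtain ⟨P, _, _, g, _, hg⟩ := exists_projective_surjective R M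
    have hS := isShortExact_ker hg
    exact ext_one_subsingleton_of_exact _ hS.1 (LinearMap.exact_iff.mpr hS.2.2.symm) hg
      (ext_subsingleton_of_projective P _ 0)
      (rTensor_injective_iff_lcomp_surjective.mp (rTensor_injective_of_flat_right hS I))
  | succ n ih =>
    obtain ⟨P, _, _, g, _, hg⟩ := exists_projective_surjective R M
    have hS := isShortExact_ker hg
    have := flat_left_of_isShortExact hS
    exact ext_succ_subsingleton_of_exact _ hS.1 (LinearMap.exact_iff.mpr hS.2.2.symm) hg _
      (ih _) (ext_subsingleton_of_projective P _ _)

theorem charExtVanishes_of_self_extension {N F : Type u} [AddCommGroup N] [Module R N]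
    [AddCommGroup F] [Module R F] [Module.Flat R F] {u : N →ₗ[R] F} {v : F →ₗ[R] N}
    (huv : IsShortExact R u v)
    (hu : ∀ (I : Type u) (_ : AddCommGroup I) (_ : Module R I), Module.Injective R I →
      Function.Injective (u.rTensor I)) :
    CharExtVanishes R N := by
  intro I _ _ hI n
  have hF := charExtVanishes_of_flat (R := R) F I _ _ hI
  have hex := LinearMap.exact_iff.mpr huv.2.2.symm
  induction n with
  | zero =>
    exact ext_one_subsingleton_of_exact _ huv.1 hex huv.2.1 (hF 0)
      (rTensor_injective_iff_lcomp_surjective.mp (hu I _ _ hI))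
  | succ n ih => exact ext_succ_subsingleton_of_exact _ huv.1 hex huv.2.1 _ ih (hF _)

end Homological

section Coherent

variable {R}

theorem IsCoherentRing.fg_ker (hR : IsCoherentRing R) {n : ℕ} (φ : (Fin n → R) →ₗ[R] R) :
    (LinearMap.ker φ).FG := by
  obtain ⟨m, g, hg, hker⟩ := hR (LinearMap.range φ)
    (Module.Finite.iff_fg.mp (Module.Finite.range φ))
  have := Module.finitePresentation_of_free_of_surjective g hg hker
  rw [← LinearMap.ker_rangeRestrict]
  exact Module.FinitePresentation.fg_ker _ φ.surjective_rangeRestrict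

/-- A character of `M` vanishing on the kernel of `α : M → N` comes from a character of `N`. -/
theorem exists_character_comp_eq {M N : Type u} [AddCommGroup M] [Module R M] [AddCommGroup N]
    [Module R N] (α : M →ₗ[R] N) (χ : CharacterModule M) (h : ∀ x, α x = 0 → χ x = 0) :
    ∃ ψ : CharacterModule N, ∀ x, χ x = ψ (α x) := by
  obtain ⟨ψ, hψ⟩ := CharacterModule.dual_surjective_of_injective
    ((LinearMap.ker α).liftQ α le_rfl) (LinearMap.ker_eq_bot.mp
      (Submodule.ker_liftQ_eq_bot _ _ _ le_rfl))
    (QuotientAddGroup.lift (LinearMap.ker α).toAddSubgroup χ h : _ →+ AddCircle (1 : ℚ))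
  exact ⟨ψ, fun x ↦ (DFunLike.congr_fun hψ (Submodule.Quotient.mk x)).symm⟩

/-- Over a coherent ring, the character module of an injective module is flat. -/
theorem IsCoherentRing.flat_characterModule (hR : IsCoherentRing R) (K : Type u) [AddCommGroup K]
    [Module R K] (hK : Module.Injective R K) : Module.Flat R (CharacterModule K) := by
  rw [Module.Flat.iff_forall_isTrivialRelation]
  intro l f x hfx
  let φ : (Fin l → R) →ₗ[R] R := Fintype.linearCombination R f
  obtain ⟨m, a, ha⟩ := Submodule.fg_iff_exists_fin_generating_family.mp (hR.fg_ker φ)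
  have hφ (v : Fin l → R) : φ v = ∑ i, v i * f i := by
    simp [φ, Fintype.linearCombination_apply]
  let α : (Fin l → K) →ₗ[R] (Fin m → K) :=
    LinearMap.pi fun j ↦ ∑ i, a j i • LinearMap.proj i
  have hα (k : Fin l → K) (j : Fin m) : α k j = ∑ i, a j i • k i := by
    simp [α]
  have hexact (k : Fin l → K) (hk : α k = 0) : ∃ c : K, ∀ i, k i = f i • c := by
    let κ : (Fin l → R) →ₗ[R] K := Fintype.linearCombination R k
    have hκ : LinearMap.ker φ ≤ LinearMap.ker κ := by
      rw [← ha, Submodule.span_le]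
      rintro _ ⟨j, rfl⟩
      simpa [κ, Fintype.linearCombination_apply, hα] using congrFun hk j
    obtain ⟨h, hh⟩ := hK.out ((LinearMap.ker φ).liftQ φ le_rfl)
      (LinearMap.ker_eq_bot.mp (Submodule.ker_liftQ_eq_bot _ _ _ le_rfl))
      ((LinearMap.ker φ).liftQ κ hκ)
    refine ⟨h 1, fun i ↦ ?_⟩
    have := hh (Submodule.Quotient.mk (Pi.single i 1))
    rw [← map_smul]
    simpa [φ, κ] using this.symm
  let χ : CharacterModule (Fin l → K) :=
    (∑ i, (x i : K →+ AddCircle (1 : ℚ)).comp (Pi.evalAddMonoidHom (fun _ ↦ K) i) :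
      (Fin l → K) →+ AddCircle (1 : ℚ))
  have hχ (k : Fin l → K) : χ k = ∑ i, x i (k i) :=
    AddMonoidHom.finsetSum_apply _ _ _
  have hsum {n : ℕ} (y : Fin n → CharacterModule K) (k : K) : (∑ j, y j) k = ∑ j, y j k :=
    AddMonoidHom.finsetSum_apply _ _ _
  obtain ⟨ψ, hψ⟩ := exists_character_comp_eq α χ fun k hk ↦ by
    obtain ⟨c, hc⟩ := hexact k hk
    have h0 := DFunLike.congr_fun hfx c
    rw [hsum] at h0
    simp_rw [hχ, hc]
    exact h0
  refine ⟨m, fun i j ↦ a j i, fun j ↦ CharacterModule.dual (LinearMap.single R (fun _ ↦ K) j) ψ,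
    fun i ↦ ?_, fun j ↦ ?_⟩
  · ext k
    have h1 : χ (Pi.single i k) = x i k := by
      rw [hχ, Finset.sum_eq_single i] <;> simp +contextual
    rw [← h1, hψ, hsum]
    have h2 : α (Pi.single i k) = ∑ j, Pi.single j (a j i • k) := by
      ext j
      simp [hα, Pi.single_apply, Finset.sum_apply]
    rw [h2, map_sum]
    rfl
  · have : a j ∈ LinearMap.ker φ := ha ▸ Submodule.subset_span ⟨j, rfl⟩
    simpa [hφ, mul_comm] using this

/-- The canonical map from a module to its double character module. -/
def doubleCharacter (M : Type u) [AddCommGroup M] [Module R M] :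
    M →ₗ[R] CharacterModule (CharacterModule M) where
  toFun x := ({ toFun := fun c ↦ c x, map_zero' := rfl, map_add' := fun _ _ ↦ rfl } :
    CharacterModule M →+ AddCircle (1 : ℚ))
  map_add' x y := by ext c; exact map_add c x y
  map_smul' r x := by ext c; rfl

theorem doubleCharacter_rTensor_injective (M : Type u) [AddCommGroup M] [Module R M] (X : Type u)
    [AddCommGroup X] [Module R X] : Function.Injective ((doubleCharacter (R := R) M).rTensor X) := by
  rw [rTensor_injective_iff_lcomp_surjective]
  intro g
  refine ⟨(CharacterModule.dual (doubleCharacter X)).comp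
    (CharacterModule.dual (CharacterModule.dual g)), ?_⟩
  ext a x
  rfl

theorem doubleCharacter_injective (M : Type u) [AddCommGroup M] [Module R M] :
    Function.Injective (doubleCharacter (R := R) M) := by
  rw [injective_iff_map_eq_zero]
  exact fun a ha ↦ CharacterModule.eq_zero_of_character_apply fun c ↦ DFunLike.congr_fun ha c

theorem IsCoherentRing.flat_doubleCharacter_quotient (hR : IsCoherentRing R) (F : Type u)
    [AddCommGroup F] [Module R F] [Module.Flat R F] :
    Module.Flat R (CharacterModule (CharacterModule F)) ∧
      Module.Flat R (_ ⧸ LinearMap.range (doubleCharacter (R := R) F)) := by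
  have := hR.flat_characterModule _ (Module.Flat.iff_characterModule_injective.mp ‹Module.Flat R F›)
  exact ⟨this, flat_right_of_isShortExact (isShortExact_mkQ (doubleCharacter_injective F))
    fun X _ _ ↦ doubleCharacter_rTensor_injective F X⟩

end Coherent

section Cosyzygies

variable {R}
variable {N : Type u} [AddCommGroup N] [Module R N]

variable (R N) in
/-- `Y` is an extension of a flat module by `N`. -/
def IsFlatExtension (Y : Type u) [AddCommGroup Y] [Module R Y] : Prop :=
  ∃ (L : Type u) (_ : AddCommGroup L) (_ : Module R L) (j : N →ₗ[R] Y) (q : Y →ₗ[R] L),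
    Module.Flat R L ∧ IsShortExact R j q

theorem IsFlatExtension.charExtVanishes {Y : Type u} [AddCommGroup Y] [Module R Y]
    (hY : IsFlatExtension R N Y) (hN : CharExtVanishes R N) : CharExtVanishes R Y := by
  obtain ⟨L, _, _, j, q, _, hjq⟩ := hY
  exact hN.middle hjq (charExtVanishes_of_flat L)

theorem flat_prod (A B : Type u) [AddCommGroup A] [Module R A] [AddCommGroup B] [Module R B]
    [Module.Flat R A] [Module.Flat R B] : Module.Flat R (A × B) :=
  flat_middle_of_isShortExact (f := LinearMap.inl R A B) (g := LinearMap.snd R A B)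
    ⟨LinearMap.inl_injective, LinearMap.snd_surjective, LinearMap.range_inl R A B⟩

theorem IsFlatExtension.prod {Y : Type u} [AddCommGroup Y] [Module R Y]
    (hY : IsFlatExtension R N Y) (D : Type u) [AddCommGroup D] [Module R D] [Module.Flat R D] :
    IsFlatExtension R N (Y × D) := by
  obtain ⟨L, _, _, j, q, _, hj, hq, hjq⟩ := hY
  refine ⟨L × D, inferInstance, inferInstance, (LinearMap.inl R Y D).comp j,
    q.prodMap LinearMap.id, flat_prod L D, ?_, ?_, ?_⟩
  · exact LinearMap.inl_injective.comp hj
  · exact Function.Surjective.prodMap hq Function.surjective_id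
  · ext ⟨y, d⟩
    have := SetLike.ext_iff.mp hjq y
    simp only [LinearMap.mem_range, LinearMap.mem_ker] at this
    simp [← this, eq_comm]

/-- A map with the same kernel as a surjection `v : F → N` factors through an injection. -/
theorem exists_injective_comp_eq {F Y : Type u} [AddCommGroup F] [Module R F] [AddCommGroup Y]
    [Module R Y] {v : F →ₗ[R] N} (hv : Function.Surjective v) (a : F →ₗ[R] Y)
    (h : LinearMap.ker a = LinearMap.ker v) :
    ∃ j : N →ₗ[R] Y, Function.Injective j ∧ j.comp v = a := by
  let e : N ≃ₗ[R] F ⧸ LinearMap.ker v := (v.quotKerEquivOfSurjective hv).symm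
  let l : (F ⧸ LinearMap.ker v) →ₗ[R] Y := (LinearMap.ker v).liftQ a h.ge
  have hl : Function.Injective l :=
    LinearMap.ker_eq_bot.mp (Submodule.ker_liftQ_eq_bot _ _ _ h.le)
  refine ⟨l.comp (e : N →ₗ[R] _), fun _ _ h ↦ e.injective (hl h), ?_⟩
  ext x
  have : e (v x) = Submodule.Quotient.mk x := by
    rw [LinearEquiv.symm_apply_eq]; rfl
  simp [this, l]

theorem IsFlatExtension.exists_embedding (hR : IsCoherentRing R) {F : Type u} [AddCommGroup F]
    [Module R F] [Module.Flat R F] {u : N →ₗ[R] F} {v : F →ₗ[R] N} (huv : IsShortExact R u v)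
    {Y : Type u} [AddCommGroup Y] [Module R Y] (hY : IsFlatExtension R N Y) :
    ∃ (K : Type u) (_ : AddCommGroup K) (_ : Module R K) (w : Y →ₗ[R] CharacterModule K),
      Module.Injective R K ∧ Module.Flat R (CharacterModule K) ∧ Function.Injective w ∧
        IsFlatExtension R N (_ ⧸ LinearMap.range w) := by
  obtain ⟨L, _, _, j, q, _, hjq⟩ := hY
  obtain ⟨hD, hDF⟩ := hR.flat_doubleCharacter_quotient F
  obtain ⟨h, hh⟩ := (charExtVanishes_of_flat L).lcomp_surjective hjq (CharacterModule F)
    (Module.Flat.iff_characterModule_injective.mp inferInstance) ((doubleCharacter (R := R) F).comp u)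
  replace hh (n : N) : h (j n) = doubleCharacter (R := R) F (u n) := LinearMap.congr_fun hh n
  let E := CharacterModule (CharacterModule F) × L
  have : Module.Flat R E := flat_prod _ L
  let δ : E →ₗ[R] CharacterModule (CharacterModule E) := doubleCharacter E
  have hδ : Function.Injective δ := doubleCharacter_injective E
  obtain ⟨hE, hEE⟩ := hR.flat_doubleCharacter_quotient E
  let w : Y →ₗ[R] CharacterModule (CharacterModule E) := δ.comp (h.prod q)
  have hker (y : Y) (hy : q y = 0) : ∃ n, y = j n := by
    obtain ⟨n, rfl⟩ : y ∈ LinearMap.range j := hjq.2.2 ▸ hy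
    exact ⟨n, rfl⟩
  have hqj (n : N) : q (j n) = 0 := by
    have : j n ∈ LinearMap.ker q := hjq.2.2 ▸ ⟨n, rfl⟩
    exact this
  have hw : Function.Injective w := by
    refine hδ.comp ((injective_iff_map_eq_zero _).mpr fun y hy ↦ ?_)
    obtain ⟨h1, h2⟩ := Prod.mk.inj hy
    obtain ⟨n, rfl⟩ := hker y h2
    rw [hh] at h1
    rw [huv.1 (doubleCharacter_injective F (h1.trans (map_zero _).symm) |>.trans
      (map_zero u).symm), map_zero]
  let b : CharacterModule (CharacterModule F) →ₗ[R] _ ⧸ LinearMap.range w :=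
    (LinearMap.range w).mkQ.comp (δ.comp (LinearMap.inl R _ _))
  have hb (d) : b d = 0 ↔ ∃ n, d = doubleCharacter (R := R) F (u n) := by
    simp only [b, LinearMap.comp_apply, Submodule.mkQ_apply, Submodule.Quotient.mk_eq_zero]
    constructor
    · rintro ⟨y, hy⟩
      obtain ⟨h1, h2⟩ := Prod.mk.inj (hδ hy)
      obtain ⟨n, rfl⟩ := hker y h2
      exact ⟨n, by rw [← hh]; exact h1.symm⟩
    · rintro ⟨n, rfl⟩
      exact ⟨j n, congrArg δ (Prod.ext (hh n) (hqj n))⟩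
  let a : F →ₗ[R] _ ⧸ LinearMap.range w := b.comp (doubleCharacter (R := R) F)
  have hav : LinearMap.ker a = LinearMap.ker v := by
    rw [← huv.2.2]
    ext x
    rw [LinearMap.mem_ker, LinearMap.comp_apply, hb]
    exact ⟨fun ⟨n, hn⟩ ↦ ⟨n, (doubleCharacter_injective F hn).symm⟩, fun ⟨n, hn⟩ ↦ ⟨n, by rw [hn]⟩⟩
  obtain ⟨j', hj', hj'v⟩ := exists_injective_comp_eq huv.2.1 a hav
  have hrange : LinearMap.range j' = LinearMap.range a := by
    rw [← hj'v, LinearMap.range_comp_of_range_eq_top _ (LinearMap.range_eq_top.mpr huv.2.1)]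
  refine ⟨CharacterModule E, inferInstance, inferInstance, w,
    Module.Flat.iff_characterModule_injective.mp inferInstance, hE, hw,
    _ ⧸ LinearMap.range a, inferInstance, inferInstance, j', (LinearMap.range a).mkQ, ?_,
    hj', Submodule.mkQ_surjective _, by rw [hrange, Submodule.ker_mkQ]⟩
  let r : (_ ⧸ LinearMap.range w) →ₗ[R] _ ⧸ LinearMap.range δ :=
    (LinearMap.range w).liftQ (LinearMap.range δ).mkQ (by
      rw [Submodule.ker_mkQ]
      exact LinearMap.range_comp_le_range _ _)
  have hrb (d) : r (b d) = 0 := (Submodule.Quotient.mk_eq_zero _).mpr ⟨_, rfl⟩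
  have hrk (z) (hz : r z = 0) : ∃ d, z = b d := by
    obtain ⟨z, rfl⟩ := Submodule.mkQ_surjective _ z
    obtain ⟨⟨d, l⟩, rfl⟩ := (Submodule.Quotient.mk_eq_zero _).mp hz
    obtain ⟨y, rfl⟩ := hjq.2.1 l
    refine ⟨d - h y, (Submodule.Quotient.eq _).mpr ⟨y, ?_⟩⟩
    have : ((h y, q y) : CharacterModule (CharacterModule F) × L) = (d, q y) - (d - h y, 0) := by
      ext1 <;> simp
    exact (congrArg δ this).trans (map_sub δ _ _)
  let s : (_ ⧸ LinearMap.range (doubleCharacter (R := R) F)) →ₗ[R] _ ⧸ LinearMap.range a :=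
    Submodule.mapQ _ _ b (by rintro _ ⟨x, rfl⟩; exact ⟨x, rfl⟩)
  let t : (_ ⧸ LinearMap.range a) →ₗ[R] _ ⧸ LinearMap.range δ :=
    (LinearMap.range a).liftQ r (by rintro _ ⟨x, rfl⟩; exact hrb _)
  have hst : IsShortExact R s t := by
    refine ⟨(injective_iff_map_eq_zero _).mpr fun d hd ↦ ?_, fun c ↦ ?_, ?_⟩
    · obtain ⟨d, rfl⟩ := Submodule.mkQ_surjective _ d
      obtain ⟨x, hx⟩ := (Submodule.Quotient.mk_eq_zero _).mp hd
      have : b (d - doubleCharacter (R := R) F x) = 0 := by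
        rw [map_sub, sub_eq_zero]; exact hx.symm
      obtain ⟨n, hn⟩ := (hb _).mp this
      exact (Submodule.Quotient.mk_eq_zero _).mpr ⟨u n + x, by rw [map_add, ← hn]; abel⟩
    · obtain ⟨c, rfl⟩ := Submodule.mkQ_surjective _ c
      exact ⟨Submodule.Quotient.mk (Submodule.Quotient.mk c), rfl⟩
    · ext z
      constructor
      · rintro ⟨d, rfl⟩
        obtain ⟨d, rfl⟩ := Submodule.mkQ_surjective _ d
        exact hrb d
      · intro hz
        obtain ⟨z, rfl⟩ := Submodule.mkQ_surjective _ z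
        obtain ⟨d, rfl⟩ := hrk z hz
        exact ⟨Submodule.Quotient.mk d, rfl⟩
  exact flat_middle_of_isShortExact hst

variable (R N) in
/-- `M` is a direct summand of an extension of a flat module by `N`. -/
def IsFlatExtensionSummand (M : Type u) [AddCommGroup M] [Module R M] : Prop :=
  ∃ (Y : Type u) (_ : AddCommGroup Y) (_ : Module R Y) (i : M →ₗ[R] Y) (p : Y →ₗ[R] M),
    IsFlatExtension R N Y ∧ p.comp i = LinearMap.id

theorem IsFlatExtensionSummand.charExtVanishes {M : Type u} [AddCommGroup M] [Module R M]
    (hM : IsFlatExtensionSummand R N M) (hN : CharExtVanishes R N) : CharExtVanishes R M := by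
  obtain ⟨Y, _, _, i, p, hY, hip⟩ := hM
  exact (hY.charExtVanishes hN).of_retract i p hip

theorem IsFlatExtensionSummand.exists_embedding (hR : IsCoherentRing R)
    (hN : CharExtVanishes R N) {F : Type u} [AddCommGroup F]
    [Module R F] [Module.Flat R F] {u : N →ₗ[R] F} {v : F →ₗ[R] N} (huv : IsShortExact R u v)
    {M : Type u} [AddCommGroup M] [Module R M] (hM : IsFlatExtensionSummand R N M) :
    ∃ (D : Type u) (_ : AddCommGroup D) (_ : Module R D) (w : M →ₗ[R] D),
      Module.Flat R D ∧ Function.Injective w ∧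
        IsFlatExtensionSummand R N (D ⧸ LinearMap.range w) := by
  obtain ⟨Y, _, _, i, p, hY, hip⟩ := hM
  obtain ⟨K, _, _, w, hK, hD, hw, hY'⟩ := hY.exists_embedding hR huv
  replace hip (m : M) : p (i m) = m := LinearMap.congr_fun hip m
  refine ⟨CharacterModule K, inferInstance, inferInstance, w.comp i, hD,
    hw.comp (Function.LeftInverse.injective hip), ?_⟩
  obtain ⟨e, he⟩ := (hY'.charExtVanishes hN).lcomp_surjective (isShortExact_mkQ hw) K hK
    ((w.comp i).comp p)
  replace he (y : Y) : e (w y) = w (i (p y)) := LinearMap.congr_fun he y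
  refine ⟨_, inferInstance, inferInstance,
    (LinearMap.range (w.comp i)).liftQ ((LinearMap.range w).mkQ.prod (LinearMap.id - e)) ?_,
    (Submodule.mapQ (LinearMap.range w) (LinearMap.range (w.comp i)) e ?_).coprod
      (LinearMap.range (w.comp i)).mkQ, hY'.prod _, ?_⟩
  · rintro _ ⟨m, rfl⟩
    simp [he, hip]
  · rintro _ ⟨y, rfl⟩
    exact ⟨p y, (he y).symm⟩
  · ext x
    simp

end Cosyzygies

section Assembly

variable {R}

variable (R) in
/-- There is a short exact sequence `0 → X → D → Y → 0` with `D` flat. -/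
def FlatStep (X Y : ModuleCat.{u} R) : Prop :=
  ∃ (D : ModuleCat.{u} R) (f : X →ₗ[R] D) (g : D →ₗ[R] Y), Module.Flat R D ∧ IsShortExact R f g

theorem CharExtVanishes.exists_flatStep {X : ModuleCat.{u} R} (hX : CharExtVanishes R X) :
    ∃ Y : ModuleCat.{u} R, CharExtVanishes R Y ∧ FlatStep R Y X := by
  obtain ⟨P, _, _, g, _, hg⟩ := exists_projective_surjective R X
  have hS := isShortExact_ker hg
  exact ⟨ModuleCat.of R (LinearMap.ker g), CharExtVanishes.left hS (charExtVanishes_of_flat P) hX,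
    ModuleCat.of R P, _, g, inferInstanceAs (Module.Flat R P), hS⟩

/-- Splice short exact sequences `0 → Z i → D i → Z (i + 1) → 0` with `D i` flat. -/
theorem isGorensteinFlat_of_flatStep (Z : ℤ → ModuleCat.{u} R)
    (hZ : ∀ i, FlatStep R (Z i) (Z (i + 1))) (hC : ∀ i, CharExtVanishes R (Z i)) :
    IsGorensteinFlat R (Z (0 + 1)) := by
  choose D f g hD hfg using hZ
  have hrange (i : ℤ) : LinearMap.range ((f (i + 1)).comp (g i)) = LinearMap.range (f (i + 1)) :=
    LinearMap.range_comp_of_range_eq_top _ (LinearMap.range_eq_top.mpr (hfg i).2.1)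
  refine ⟨fun i ↦ D i, inferInstance, inferInstance, fun i ↦ (f (i + 1)).comp (g i), hD,
    fun i ↦ ?_, ?_, ?_⟩
  · rw [hrange, LinearMap.ker_comp_of_ker_eq_bot _ (LinearMap.ker_eq_bot.mpr (hfg _).1),
      (hfg (i + 1)).2.2]
  · rw [hrange]
    exact ⟨LinearEquiv.ofInjective _ (hfg (0 + 1)).1⟩
  · intro I _ _ hI i
    have hinj := (hC (i + 1 + 1 + 1)).rTensor_injective (hfg (i + 1 + 1)) I hI
    have hex := LinearMap.exact_iff.mp (rTensor_exact I
      (LinearMap.exact_iff.mpr (hfg (i + 1)).2.2.symm) (hfg (i + 1)).2.1)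
    rw [LinearMap.rTensor_comp, LinearMap.rTensor_comp, LinearMap.range_comp_of_range_eq_top _
      (LinearMap.range_eq_top.mpr (LinearMap.rTensor_surjective I (hfg i).2.1)),
      LinearMap.ker_comp_of_ker_eq_bot _ (LinearMap.ker_eq_bot.mpr hinj), hex]

theorem isGorensteinFlat_of_forall_exists_flatStep (P : ModuleCat.{u} R → Prop)
    (hP : ∀ X, P X → CharExtVanishes R X) (hstep : ∀ X, P X → ∃ Y, P Y ∧ FlatStep R X Y)
    {M : ModuleCat.{u} R} (hM : P M) : IsGorensteinFlat R M := by
  choose! r hr hrs using hstep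
  have hl (X : ModuleCat.{u} R) : ∃ Y : ModuleCat.{u} R, CharExtVanishes R X →
      CharExtVanishes R Y ∧ FlatStep R Y X := by
    by_cases hX : CharExtVanishes R X
    · obtain ⟨Y, hY⟩ := hX.exists_flatStep
      exact ⟨Y, fun _ ↦ hY⟩
    · exact ⟨X, fun h ↦ (hX h).elim⟩
  choose l hl using hl
  have ha (n : ℕ) : P (r^[n] M) := by
    induction n with
    | zero => exact hM
    | succ n ih => rw [Function.iterate_succ_apply']; exact hr _ ih
  have hb (n : ℕ) : CharExtVanishes R (l^[n] M) := by
    induction n with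
    | zero => exact hP _ hM
    | succ n ih => rw [Function.iterate_succ_apply']; exact (hl _ ih).1
  let Z : ℤ → ModuleCat.{u} R
    | .ofNat 0 => l^[1] M
    | .ofNat (n + 1) => r^[n] M
    | .negSucc n => l^[n + 2] M
  have hZ : Z (0 + 1) = M := rfl
  rw [← hZ]
  refine isGorensteinFlat_of_flatStep Z (fun i ↦ ?_) fun i ↦ ?_
  · match i with
    | .ofNat 0 => exact (hl M (hP M hM)).2
    | .ofNat (n + 1) =>
      change FlatStep R (r^[n] M) (r^[n + 1] M)
      rw [Function.iterate_succ_apply']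
      exact hrs _ (ha n)
    | .negSucc 0 => exact (hl (l M) (hb 1)).2
    | .negSucc (n + 1) =>
      change FlatStep R (l^[n + 3] M) (l^[n + 2] M)
      rw [Function.iterate_succ_apply' l (n + 2)]
      exact (hl _ (hb (n + 2))).2
  · match i with
    | .ofNat 0 => exact hb 1
    | .ofNat (n + 1) => exact hP _ (ha n)
    | .negSucc n => exact hb (n + 2)

theorem IsStronglyGorensteinFlat.exists_isShortExact {N : Type u} [AddCommGroup N] [Module R N]
    (hN : IsStronglyGorensteinFlat R N) :
    ∃ (F : Type u) (_ : AddCommGroup F) (_ : Module R F) (u : N →ₗ[R] F) (v : F →ₗ[R] N),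
      Module.Flat R F ∧ IsShortExact R u v ∧
        ∀ (I : Type u) (_ : AddCommGroup I) (_ : Module R I), Module.Injective R I →
          Function.Injective (u.rTensor I) := by
  obtain ⟨F, _, _, f, hF, hf, ⟨e⟩, hI⟩ := hN
  let u : N →ₗ[R] F := (LinearMap.range f).subtype.comp (e : N →ₗ[R] _)
  let v : F →ₗ[R] N := (e.symm : _ →ₗ[R] N).comp f.rangeRestrict
  have hu : Function.Injective u := fun _ _ h ↦ e.injective (Subtype.val_injective h)
  have hv : Function.Surjective v := e.symm.surjective.comp f.surjective_rangeRestrict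
  have huv : u.comp v = f := by ext; simp [u, v]
  have hS : IsShortExact R u v := by
    refine ⟨hu, hv, ?_⟩
    rw [← LinearMap.range_comp_of_range_eq_top u (LinearMap.range_eq_top.mpr hv),
      ← LinearMap.ker_comp_of_ker_eq_bot v (LinearMap.ker_eq_bot.mpr hu), huv, hf]
  refine ⟨F, inferInstance, inferInstance, u, v, hF, hS, fun I _ _ h ↦ ?_⟩
  have hvu : v.comp u = 0 := (LinearMap.exact_iff.mpr hS.2.2.symm).linearMap_comp_eq_zero
  rw [injective_iff_map_eq_zero]
  intro x hx
  obtain ⟨y, rfl⟩ := LinearMap.rTensor_surjective I hv x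
  rw [← LinearMap.comp_apply, ← LinearMap.rTensor_comp, huv] at hx
  obtain ⟨z, rfl⟩ : y ∈ LinearMap.range (f.rTensor I) := hI I _ _ h ▸ hx
  rw [← LinearMap.comp_apply, ← LinearMap.rTensor_comp, ← huv, ← LinearMap.comp_assoc, hvu,
    LinearMap.zero_comp, LinearMap.rTensor_zero, LinearMap.zero_apply]

theorem IsStronglyGorensteinFlat.isGorensteinFlat_of_retract (hR : IsCoherentRing R)
    {M N : Type u} [AddCommGroup M] [Module R M] [AddCommGroup N] [Module R N]
    (hN : IsStronglyGorensteinFlat R N) (i : M →ₗ[R] N) (p : N →ₗ[R] M)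
    (hip : p.comp i = LinearMap.id) : IsGorensteinFlat R M := by
  obtain ⟨F, _, _, u, v, _, huv, hu⟩ := hN.exists_isShortExact
  have hNC := charExtVanishes_of_self_extension huv hu
  refine isGorensteinFlat_of_forall_exists_flatStep (M := ModuleCat.of R M)
    (fun X ↦ IsFlatExtensionSummand R N X) (fun X hX ↦ hX.charExtVanishes hNC) (fun X hX ↦ ?_) ?_
  · obtain ⟨D, _, _, w, hD, hw, hY⟩ := hX.exists_embedding hR hNC huv
    exact ⟨ModuleCat.of R (D ⧸ LinearMap.range w), hY, ModuleCat.of R D, w, _, hD,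
      isShortExact_mkQ hw⟩
  · refine ⟨N, inferInstance, inferInstance, i, p, ⟨PUnit, inferInstance, inferInstance,
      LinearMap.id, 0, inferInstance, Function.injective_id,
      fun _ ↦ ⟨0, Subsingleton.elim _ _⟩, ?_⟩, hip⟩
    rw [LinearMap.range_id, LinearMap.ker_zero]

end Assembly

section Shift

open TensorProduct DirectSum

variable {R}
variable {F : ℤ → Type u} [∀ i, AddCommGroup (F i)] [∀ i, Module R (F i)]

/-- The endomorphism of `⨁ i, F i` induced by maps `F i → F (i + 1)`. -/
def directSumShift (d : ∀ i, F i →ₗ[R] F (i + 1)) : (⨁ i, F i) →ₗ[R] ⨁ i, F i :=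
  DirectSum.toModule R ℤ _ fun i ↦ (DirectSum.lof R ℤ F (i + 1)).comp (d i)

theorem directSumShift_lof (d : ∀ i, F i →ₗ[R] F (i + 1)) (i : ℤ) (x : F i) :
    directSumShift d (DirectSum.lof R ℤ F i x) = DirectSum.lof R ℤ F (i + 1) (d i x) := by
  simp [directSumShift]

theorem directSumShift_apply (d : ∀ i, F i →ₗ[R] F (i + 1)) (x : ⨁ i, F i) (i : ℤ) :
    directSumShift d x (i + 1) = d i (x i) := by
  induction x using DirectSum.induction_on with
  | zero => simp
  | add x y hx hy => simp [hx, hy]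
  | of j y =>
    rw [← DirectSum.lof_eq_of R, directSumShift_lof]
    by_cases h : j = i
    · subst h
      rw [DirectSum.lof_apply, DirectSum.lof_apply]
    · rw [DirectSum.lof_eq_of, DirectSum.lof_eq_of, DirectSum.of_eq_of_ne _ _ _ (by grind),
        DirectSum.of_eq_of_ne _ _ _ (by grind), map_zero]

theorem range_directSumShift {d : ∀ i, F i →ₗ[R] F (i + 1)}
    (hd : ∀ i, LinearMap.range (d i) = LinearMap.ker (d (i + 1))) :
    LinearMap.range (directSumShift d) = LinearMap.ker (directSumShift d) := by
  have hzero (i : ℤ) (y : F i) : d (i + 1) (d i y) = 0 := by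
    have : d i y ∈ LinearMap.ker (d (i + 1)) := hd i ▸ ⟨y, rfl⟩
    exact this
  apply le_antisymm
  · rintro _ ⟨x, rfl⟩
    induction x using DirectSum.induction_on with
    | zero => simp
    | add x y hx hy => rw [map_add]; exact add_mem hx hy
    | of j y =>
      rw [← DirectSum.lof_eq_of R, directSumShift_lof, LinearMap.mem_ker, directSumShift_lof,
        hzero, map_zero]
  · intro x hx
    classical
    rw [← DirectSum.sum_support_of x]
    refine sum_mem fun i _ ↦ ?_
    obtain ⟨j, rfl⟩ : ∃ j, i = j + 1 := ⟨i - 1, by ring⟩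
    have h : x (j + 1) ∈ LinearMap.ker (d (j + 1)) := by
      rw [LinearMap.mem_ker, ← directSumShift_apply, LinearMap.mem_ker.mp hx]
      rfl
    rw [← hd] at h
    obtain ⟨y, hy⟩ := h
    exact ⟨DirectSum.lof R ℤ F j y, by rw [directSumShift_lof, hy, DirectSum.lof_eq_of]⟩

theorem directSumLeft_comp_rTensor_directSumShift (d : ∀ i, F i →ₗ[R] F (i + 1)) (I : Type u)
    [AddCommGroup I] [Module R I] :
    (TensorProduct.directSumLeft R R F I : _ →ₗ[R] _).comp ((directSumShift d).rTensor I) =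
      (directSumShift fun i ↦ (d i).rTensor I).comp
        (TensorProduct.directSumLeft R R F I : _ →ₗ[R] _) := by
  ext i x y : 5
  simp [directSumShift_lof, TensorProduct.directSumLeft_tmul_lof]

theorem range_rTensor_directSumShift {d : ∀ i, F i →ₗ[R] F (i + 1)} (I : Type u)
    [AddCommGroup I] [Module R I]
    (hd : ∀ i, LinearMap.range ((d i).rTensor I) = LinearMap.ker ((d (i + 1)).rTensor I)) :
    LinearMap.range ((directSumShift d).rTensor I) =
      LinearMap.ker ((directSumShift d).rTensor I) := by
  let e := TensorProduct.directSumLeft R R F I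
  have he (x) : e ((directSumShift d).rTensor I x) =
      directSumShift (fun i ↦ (d i).rTensor I) (e x) :=
    LinearMap.congr_fun (directSumLeft_comp_rTensor_directSumShift d I) x
  have h := range_directSumShift hd
  ext x
  have hx := SetLike.ext_iff.mp h (e x)
  rw [LinearMap.mem_ker, ← he, map_eq_zero_iff e e.injective] at hx
  rw [LinearMap.mem_ker, ← hx]
  constructor
  · rintro ⟨y, rfl⟩
    exact ⟨e y, (he y).symm⟩
  · rintro ⟨y, hy⟩
    exact ⟨e.symm y, e.injective (by rw [he, e.apply_symm_apply, hy])⟩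

theorem IsGorensteinFlat.exists_retract {M : Type u} [AddCommGroup M] [Module R M]
    (hM : IsGorensteinFlat R M) :
    ∃ (N : Type u) (_ : AddCommGroup N) (_ : Module R N), IsStronglyGorensteinFlat R N ∧
      ∃ (i : M →ₗ[R] N) (p : N →ₗ[R] M), p.comp i = LinearMap.id := by
  obtain ⟨F, _, _, d, hF, hd, ⟨e⟩, hI⟩ := hM
  refine ⟨LinearMap.range (directSumShift d), inferInstance, inferInstance,
    ⟨⨁ i, F i, inferInstance, inferInstance, directSumShift d, inferInstance,
      range_directSumShift hd, ⟨.refl R _⟩,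
      fun I _ _ h ↦ range_rTensor_directSumShift I (hI I _ _ h)⟩, ?_⟩
  let ι : LinearMap.range (d 0) →ₗ[R] LinearMap.range (directSumShift d) :=
    (DirectSum.lof R ℤ F (0 + 1)).restrict (by
      rintro _ ⟨x, rfl⟩
      exact ⟨DirectSum.lof R ℤ F 0 x, directSumShift_lof d 0 x⟩)
  let π : LinearMap.range (directSumShift d) →ₗ[R] LinearMap.range (d 0) :=
    (DirectSum.component R ℤ F (0 + 1)).restrict (by
      rintro _ ⟨x, rfl⟩
      exact ⟨x 0, (directSumShift_apply d x 0).symm⟩)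
  refine ⟨ι.comp (e : M →ₗ[R] _), (e.symm : _ →ₗ[R] M).comp π, ?_⟩
  have hπ (x) : π (ι x) = x := Subtype.ext (DirectSum.component.lof_self R (0 + 1) x.1)
  ext m
  simp [hπ]

end Shift

/-- Proposition 1.3: over a coherent ring, a module is Gorenstein flat iff it is a direct
summand of a strongly Gorenstein flat module. -/
theorem statement_17 (R : Type u) [CommRing R] (hcoh : IsCoherentRing R)
    (M : Type u) [AddCommGroup M] [Module R M] :
    IsGorensteinFlat R M ↔
      ∃ (N : Type u) (_ : AddCommGroup N) (_ : Module R N),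
        IsStronglyGorensteinFlat R N ∧
          ∃ (i : M →ₗ[R] N) (p : N →ₗ[R] M), p.comp i = LinearMap.id := by
  exact ⟨IsGorensteinFlat.exists_retract, fun ⟨_, _, _, hN, i, p, hip⟩ ↦
    hN.isGorensteinFlat_of_retract hcoh i p hip⟩
end
end
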